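/- Let c ≥ 6, ε ∈ (0,1) and n ≥ 2. Over a uniformly random permutation π, with probability at least 1 − n^{1 − c/2}, every node u that is placed into a singleton cluster at some iteration i of sequential Truncated-Pivot (necessarily i = ⌈τ_u⌉) satisfies deg_i(u) ≤ ε·deg(u). -/

import Mathlib

open scoped Classical

namespace TruncatedPivot

/-- Status of a node during the run of (sequential) Truncated-Pivot. -/
inductive Status (N : ℕ) where
  | active : Status N
  | singleton : Status N
  | clustered : Fin N → Status N
  deriving DecidableEq

variable {N : ℕ}

/-- Degree of `u`: number of positive edges incident on `u`. -/
def deg (adj : Fin N → Fin N → Bool) (u : Fin N) : ℕ :=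
  (Finset.univ.filter fun v => adj u v = true).card

/-- Number of disagreements of the clustering whose parts are the fibers of `f`:
positive pairs split between two parts plus negative pairs inside one part. -/
def cost (adj : Fin N → Fin N → Bool) (f : Fin N → Fin N) : ℕ :=
  (Finset.univ.filter fun p : Fin N × Fin N =>
    p.1 < p.2 ∧ ((adj p.1 p.2 = true ∧ f p.1 ≠ f p.2) ∨
      (adj p.1 p.2 = false ∧ f p.1 = f p.2))).card

/-- Minimum number of disagreements over all clusterings (every partition of `Fin N`
arises as the fibers of some `f : Fin N → Fin N`). -/
noncomputable def OPT (adj : Fin N → Fin N → Bool) : ℕ :=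
  sInf (Set.range (cost adj))

/-- The singleton-creating sub-step of iteration `i` of sequential Truncated-Pivot:
every active node `v` with `deg v ≥ (c/ε)·(N·log N)/i` (equivalently
`deg v · i ≥ (c/ε)·(N·log N)`, as `i ≥ 1`) becomes a singleton cluster. -/
noncomputable def singStep (adj : Fin N → Fin N → Bool) (c ε : ℝ) (i : ℕ)
    (s : Fin N → Status N) : Fin N → Status N := fun v =>
  if s v = Status.active ∧ (c / ε) * ((N : ℝ) * Real.log N) ≤ (deg adj v : ℝ) * (i : ℝ) then
    Status.singleton
  else s v

/-- The pivot sub-step: if `u` is still active, it forms a pivot cluster together with all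
of its currently active positive neighbors. -/
def pivStep (adj : Fin N → Fin N → Bool) (u : Fin N) (s : Fin N → Status N) :
    Fin N → Status N := fun v =>
  if s u = Status.active ∧ s v = Status.active ∧ (v = u ∨ adj u v = true) then
    Status.clustered u
  else s v

/-- `seqStates adj c ε π k` is the status of every node after the first `k` iterations of
sequential Truncated-Pivot run with permutation `π` (iteration `i = k+1` processes the
node at position `i`, i.e. `π.symm ⟨k⟩`). -/
noncomputable def seqStates (adj : Fin N → Fin N → Bool) (c ε : ℝ) (π : Equiv.Perm (Fin N)) :
    ℕ → Fin N → Status N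
  | 0 => fun _ => Status.active
  | k + 1 =>
    if h : k < N then
      pivStep adj (π.symm ⟨k, h⟩) (singStep adj c ε (k + 1) (seqStates adj c ε π k))
    else seqStates adj c ε π k

/-- The cluster label (representative) of each node in the clustering output by
sequential Truncated-Pivot: members of the pivot cluster of pivot `p` get label `p`,
singleton clusters get the node itself. -/
noncomputable def seqLabel (adj : Fin N → Fin N → Bool) (c ε : ℝ) (π : Equiv.Perm (Fin N))
    (v : Fin N) : Fin N :=
  match seqStates adj c ε π N v with
  | Status.clustered p => p
  | _ => v

/-- The state in iteration `k+1` just after the singleton sub-step and right before the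
pivot sub-step. -/
noncomputable def midState (adj : Fin N → Fin N → Bool) (c ε : ℝ) (π : Equiv.Perm (Fin N))
    (k : ℕ) : Fin N → Status N :=
  singStep adj c ε (k + 1) (seqStates adj c ε π k)

/-- Membership in the (potential) pivot cluster of pivot `p`. -/
def inPivCluster (adj : Fin N → Fin N → Bool) (p v : Fin N) : Prop :=
  v = p ∨ adj p v = true

/-- The (positive) edge `{a,b}` is cut by the pivot cluster created at iteration `k+1`:
the pivot and both endpoints are active when the cluster is created, and exactly one of
`a`, `b` is included in the cluster. -/
def cutAt (adj : Fin N → Fin N → Bool) (c ε : ℝ) (π : Equiv.Perm (Fin N)) (k : Fin N)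
    (a b : Fin N) : Prop :=
  midState adj c ε π k.val (π.symm k) = Status.active ∧
  midState adj c ε π k.val a = Status.active ∧
  midState adj c ε π k.val b = Status.active ∧
  ((inPivCluster adj (π.symm k) a ∧ ¬ inPivCluster adj (π.symm k) b) ∨
    (inPivCluster adj (π.symm k) b ∧ ¬ inPivCluster adj (π.symm k) a))

/-- `C^pivot`: the number of disagreements induced by the pivot clusters of sequential
Truncated-Pivot: negative pairs inside a common pivot cluster, plus positive edges cut
by a pivot cluster at the iteration it was created. -/
noncomputable def Cpivot (adj : Fin N → Fin N → Bool) (c ε : ℝ) (π : Equiv.Perm (Fin N)) : ℕ :=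
  (Finset.univ.filter fun p : Fin N × Fin N =>
    p.1 < p.2 ∧
      ((adj p.1 p.2 = true ∧ ∃ k : Fin N, cutAt adj c ε π k p.1 p.2) ∨
        (adj p.1 p.2 = false ∧ ∃ q : Fin N,
          seqStates adj c ε π N p.1 = Status.clustered q ∧
          seqStates adj c ε π N p.2 = Status.clustered q))).card

/-- A bad triangle: three distinct vertices with exactly two positive edges. -/
def IsBadTriangle (adj : Fin N → Fin N → Bool) (t : Finset (Fin N)) : Prop :=
  ∃ u v w : Fin N, t = {u, v, w} ∧ u ≠ v ∧ v ≠ w ∧ u ≠ w ∧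
    adj u v = true ∧ adj v w = true ∧ adj u w = false

/-- The set `T` of all bad triangles. -/
noncomputable def badTriangles (adj : Fin N → Fin N → Bool) : Finset (Finset (Fin N)) :=
  Finset.univ.filter (IsBadTriangle adj)

/-- The event `A_t`: at some iteration of sequential Truncated-Pivot all three nodes of the
bad triangle `t` are active and one of them is the node of that iteration (hence it
creates a pivot cluster). -/
def eventA (adj : Fin N → Fin N → Bool) (c ε : ℝ) (t : Finset (Fin N))
    (π : Equiv.Perm (Fin N)) : Prop :=
  ∃ k : Fin N, π.symm k ∈ t ∧ ∀ x ∈ t, midState adj c ε π k.val x = Status.active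

/-- `N_i(u)`: positive neighbors `v` of `u` with `deg v ≤ deg u` that have not joined a
pivot cluster before iteration `i` (i.e. in the state at the beginning of iteration `i`). -/
noncomputable def NdegI (adj : Fin N → Fin N → Bool) (c ε : ℝ) (π : Equiv.Perm (Fin N))
    (i : ℕ) (u : Fin N) : Finset (Fin N) :=
  Finset.univ.filter fun v => adj u v = true ∧ deg adj v ≤ deg adj u ∧
    ∀ p : Fin N, seqStates adj c ε π (i - 1) v ≠ Status.clustered p

/-- `u` is placed into a singleton cluster at iteration `i` (`1 ≤ i ≤ N`). -/
def becomesSingletonAt (adj : Fin N → Fin N → Bool) (c ε : ℝ) (π : Equiv.Perm (Fin N))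
    (u : Fin N) (i : ℕ) : Prop :=
  1 ≤ i ∧ i ≤ N ∧ seqStates adj c ε π (i - 1) u = Status.active ∧
    seqStates adj c ε π i u = Status.singleton

/-- `E^sin`: positive edges with at least one endpoint in a singleton cluster. -/
noncomputable def Esin (adj : Fin N → Fin N → Bool) (c ε : ℝ) (π : Equiv.Perm (Fin N)) :
    Finset (Fin N × Fin N) :=
  Finset.univ.filter fun p => p.1 < p.2 ∧ adj p.1 p.2 = true ∧
    (seqStates adj c ε π N p.1 = Status.singleton ∨
      seqStates adj c ε π N p.2 = Status.singleton)

/-- A good edge of `E^sin`: one endpoint is placed into a singleton cluster at some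
iteration `i` and the other endpoint had joined a pivot cluster at some iteration `j < i`. -/
def goodPair (adj : Fin N → Fin N → Bool) (c ε : ℝ) (π : Equiv.Perm (Fin N))
    (a b : Fin N) : Prop :=
  (∃ i : ℕ, becomesSingletonAt adj c ε π a i ∧
    ∃ p : Fin N, seqStates adj c ε π (i - 1) b = Status.clustered p) ∨
  (∃ i : ℕ, becomesSingletonAt adj c ε π b i ∧
    ∃ p : Fin N, seqStates adj c ε π (i - 1) a = Status.clustered p)

/-- `E^bad`: the edges of `E^sin` that are not good. -/
noncomputable def Ebad (adj : Fin N → Fin N → Bool) (c ε : ℝ) (π : Equiv.Perm (Fin N)) :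
    Finset (Fin N × Fin N) :=
  (Esin adj c ε π).filter fun p => ¬ goodPair adj c ε π p.1 p.2

/-- A node `u` is interesting for permutation `π` iff `π_u < τ_u`, i.e.
`π_u · deg u < (c/ε)·(N·log N)` where `π_u ∈ {1,…,N}` is the position of `u`. -/
def interesting (adj : Fin N → Fin N → Bool) (c ε : ℝ) (π : Equiv.Perm (Fin N))
    (u : Fin N) : Prop :=
  (((π u).val : ℝ) + 1) * (deg adj u : ℝ) < (c / ε) * ((N : ℝ) * Real.log N)

/-- The greedy maximal independent set of `G_store` (the subgraph induced by the
interesting nodes) along `π`: nodes are processed in increasing order of position and a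
node joins iff it is interesting and has no earlier neighbor already in the set. -/
noncomputable def pivots (adj : Fin N → Fin N → Bool) (c ε : ℝ) (π : Equiv.Perm (Fin N)) :
    Finset (Fin N) :=
  (List.finRange N).foldl
    (fun I j =>
      if interesting adj c ε π (π.symm j) ∧ ∀ v ∈ I, adj (π.symm j) v = false then
        insert (π.symm j) I
      else I) ∅

/-- The cluster label of each node in the clustering output by parallel Truncated-Pivot:
pivots are their own label; a non-pivot `u` joins its pivot positive neighbor `v` of
smallest position provided `π_v < τ_u`; all remaining nodes form singleton clusters. -/
noncomputable def parLabel (adj : Fin N → Fin N → Bool) (c ε : ℝ) (π : Equiv.Perm (Fin N))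
    (u : Fin N) : Fin N :=
  if u ∈ pivots adj c ε π then u
  else
    let S := (pivots adj c ε π).filter fun v => adj u v = true ∧
      (((π v).val : ℝ) + 1) * (deg adj u : ℝ) < (c / ε) * ((N : ℝ) * Real.log N)
    if h : S.Nonempty then π.symm ((S.image fun v => π v).min' (h.image _)) else u

/-- The number of positive edges with at least one interesting endpoint (i.e. with at
least one endpoint in `G_store`). -/
noncomputable def interEdges (adj : Fin N → Fin N → Bool) (c ε : ℝ)
    (π : Equiv.Perm (Fin N)) : Finset (Fin N × Fin N) :=
  Finset.univ.filter fun p => p.1 < p.2 ∧ adj p.1 p.2 = true ∧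
    (interesting adj c ε π p.1 ∨ interesting adj c ε π p.2)

/-- Probability of an event over a uniformly random permutation of `Fin N`. -/
noncomputable def Pr (N : ℕ) (P : Equiv.Perm (Fin N) → Prop) : ℝ :=
  ((Finset.univ.filter P).card : ℝ) / (Nat.factorial N : ℝ)

/-- Expectation of a real random variable over a uniformly random permutation of `Fin N`. -/
noncomputable def Ex (N : ℕ) (X : Equiv.Perm (Fin N) → ℝ) : ℝ :=
  (∑ π : Equiv.Perm (Fin N), X π) / (Nat.factorial N : ℝ)



/-- Exchanging the node at position `k` with a node at a later position: if the event `P` and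
the random set `S` ignore such exchanges, and `S` avoids the positions before `k`, then the node
at position `k` hits `S` with conditional probability at least `s / N`. -/
lemma card_mul_le_card_hit (k : Fin N) (P : Equiv.Perm (Fin N) → Prop)
    (S : Equiv.Perm (Fin N) → Finset (Fin N)) (s : ℝ)
    [DecidablePred P] [DecidablePred fun π => P π ∧ π.symm k ∈ S π]
    (hP : ∀ m, k ≤ m → ∀ π, P π → P (Equiv.swap k m * π))
    (hS : ∀ m, k ≤ m → ∀ π, S (Equiv.swap k m * π) = S π)
    (hlate : ∀ π, P π → ∀ v ∈ S π, k ≤ π v)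
    (hcard : ∀ π, P π → s ≤ ((S π).card : ℝ)) :
    s * ((Finset.univ.filter P).card : ℝ) ≤
      N * ((Finset.univ.filter fun π => P π ∧ π.symm k ∈ S π).card : ℝ) := by
  have hswap : ∀ m, k ≤ m →
      (Finset.univ.filter fun π => P π ∧ π.symm m ∈ S π).card ≤
        (Finset.univ.filter fun π => P π ∧ π.symm k ∈ S π).card := by
    intro m hm
    refine Finset.card_le_card_of_injOn (fun π => Equiv.swap k m * π) ?_
      fun a _ b _ h => mul_left_cancel h
    intro π hπ
    simp only [Finset.coe_filter, Finset.mem_univ, true_and, Set.mem_ofPred_eq] at hπ ⊢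
    refine ⟨hP m hm π hπ.1, ?_⟩
    rw [hS m hm]
    simpa [← Equiv.Perm.inv_def, mul_inv_rev] using hπ.2
  have hcount : ∀ π, P π → (S π).card =
      ∑ m ∈ Finset.univ.filter (k ≤ ·), if π.symm m ∈ S π then 1 else 0 := by
    intro π hπ
    rw [← Finset.card_filter]
    refine Finset.card_bij (fun v _ => π v) ?_ (fun a _ b _ h => π.injective h) ?_
    · intro v hv
      simp [hlate π hπ v hv, hv]
    · intro m hm
      exact ⟨π.symm m, (Finset.mem_filter.1 hm).2, by simp⟩
  have hnat : ∑ π ∈ Finset.univ.filter P, (S π).card ≤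
      N * (Finset.univ.filter fun π => P π ∧ π.symm k ∈ S π).card := by
    calc ∑ π ∈ Finset.univ.filter P, (S π).card
        = ∑ π ∈ Finset.univ.filter P, ∑ m ∈ Finset.univ.filter (k ≤ ·),
            if π.symm m ∈ S π then 1 else 0 :=
          Finset.sum_congr rfl fun π hπ => hcount π (Finset.mem_filter.1 hπ).2
      _ = ∑ m ∈ Finset.univ.filter (k ≤ ·),
            (Finset.univ.filter fun π => P π ∧ π.symm m ∈ S π).card := by
          rw [Finset.sum_comm]
          refine Finset.sum_congr rfl fun m _ => ?_
          rw [← Finset.card_filter, Finset.filter_filter]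
      _ ≤ ∑ _m ∈ Finset.univ.filter (k ≤ ·),
            (Finset.univ.filter fun π => P π ∧ π.symm k ∈ S π).card :=
          Finset.sum_le_sum fun m hm => hswap m (Finset.mem_filter.1 hm).2
      _ ≤ _ := by
          rw [Finset.sum_const, smul_eq_mul]
          exact Nat.mul_le_mul_right _ ((Finset.card_le_univ _).trans (by simp))
  calc s * ((Finset.univ.filter P).card : ℝ)
      = ∑ π ∈ Finset.univ.filter P, s := by rw [Finset.sum_const, nsmul_eq_mul, mul_comm]
    _ ≤ ∑ π ∈ Finset.univ.filter P, ((S π).card : ℝ) :=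
        Finset.sum_le_sum fun π hπ => hcard π (Finset.mem_filter.1 hπ).2
    _ ≤ _ := by exact_mod_cast hnat

section Run

variable {adj : Fin N → Fin N → Bool} {c ε : ℝ} {π : Equiv.Perm (Fin N)} {k : ℕ} {u v p : Fin N}

/-- One iteration of the run. -/
lemma seqStates_succ (h : k < N) : seqStates adj c ε π (k + 1) =
    pivStep adj (π.symm ⟨k, h⟩) (singStep adj c ε (k + 1) (seqStates adj c ε π k)) := by
  simp [seqStates, h]

/-- The state after `k` iterations depends only on the first `k` nodes. -/
lemma seqStates_congr {π' : Equiv.Perm (Fin N)}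
    (h : ∀ j : Fin N, j.val < k → π.symm j = π'.symm j) :
    seqStates adj c ε π k = seqStates adj c ε π' k := by
  induction k with
  | zero => rfl
  | succ k ih =>
    have ih' := ih fun j hj => h j (by omega)
    by_cases hk : k < N
    · rw [seqStates_succ hk, seqStates_succ hk, ih', h ⟨k, hk⟩ (Nat.lt_succ_self k)]
    · simp only [seqStates, hk, dite_false, ih']

/-- Members of a pivot cluster stay in it. -/
lemma clustered_mono {l : ℕ} (hkl : k ≤ l)
    (h : seqStates adj c ε π k v = Status.clustered p) :
    seqStates adj c ε π l v = Status.clustered p := by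
  induction l, hkl using Nat.le_induction with
  | base => exact h
  | succ l _ ih =>
    by_cases hl : l < N
    · rw [seqStates_succ hl]
      simp [pivStep, singStep, ih]
    · simpa [seqStates, hl] using ih

/-- Active nodes were active one iteration earlier. -/
lemma active_of_active_succ (h : seqStates adj c ε π (k + 1) v = Status.active) :
    seqStates adj c ε π k v = Status.active := by
  by_cases hk : k < N
  · rw [seqStates_succ hk] at h
    simp only [pivStep, singStep] at h
    split_ifs at h <;> exact h
  · simpa [seqStates, hk] using h

/-- A singleton node has reached the degree threshold. -/
lemma threshold_le_of_singleton (h : seqStates adj c ε π k v = Status.singleton) :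
    (c / ε) * ((N : ℝ) * Real.log N) ≤ (deg adj v : ℝ) * (k : ℝ) := by
  induction k with
  | zero => simp [seqStates] at h
  | succ k ih =>
    have mono : (deg adj v : ℝ) * (k : ℝ) ≤ (deg adj v : ℝ) * ((k + 1 : ℕ) : ℝ) := by
      gcongr
      exact Nat.le_succ k
    by_cases hk : k < N
    · rw [seqStates_succ hk] at h
      by_contra! hlt
      refine absurd (ih ?_) (not_le.2 (mono.trans_lt hlt))
      simp only [pivStep, singStep, not_le.2 hlt, and_false, if_false] at h
      split_ifs at h <;> exact h
    · exact (ih (by simpa [seqStates, hk] using h)).trans mono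

/-- A node below the degree threshold that has joined no pivot cluster is active. -/
lemma active_of_not_clustered
    (hlt : (deg adj v : ℝ) * (k : ℝ) < (c / ε) * ((N : ℝ) * Real.log N))
    (h : ∀ p, seqStates adj c ε π k v ≠ Status.clustered p) :
    seqStates adj c ε π k v = Status.active := by
  cases hv : seqStates adj c ε π k v with
  | active => rfl
  | singleton => exact absurd (threshold_le_of_singleton hv) (not_le.2 hlt)
  | clustered p => exact absurd hv (h p)

/-- An active node below the degree threshold becomes a pivot and captures its active neighbors
below the threshold. -/
lemma clustered_succ_of_active (hk : k < N)
    (hp : seqStates adj c ε π k (π.symm ⟨k, hk⟩) = Status.active)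
    (hpd : (deg adj (π.symm ⟨k, hk⟩) : ℝ) * ((k + 1 : ℕ) : ℝ) <
      (c / ε) * ((N : ℝ) * Real.log N))
    (hv : seqStates adj c ε π k v = Status.active)
    (hvd : (deg adj v : ℝ) * ((k + 1 : ℕ) : ℝ) < (c / ε) * ((N : ℝ) * Real.log N))
    (hadj : v = π.symm ⟨k, hk⟩ ∨ adj (π.symm ⟨k, hk⟩) v = true) :
    seqStates adj c ε π (k + 1) v = Status.clustered (π.symm ⟨k, hk⟩) := by
  rw [seqStates_succ hk]
  have h1 := not_le.2 hpd
  have h2 := not_le.2 hvd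
  simp only [pivStep, singStep, hp, hv, h1, h2, and_false, if_false, true_and, hadj, if_true]

/-- If `u` becomes a singleton at iteration `i`, then `i` is the first iteration at which `u`
meets the degree threshold. -/
lemma threshold_of_becomesSingletonAt {i : ℕ}
    (hT : 0 < (c / ε) * ((N : ℝ) * Real.log N))
    (h : becomesSingletonAt adj c ε π u i) :
    (deg adj u : ℝ) * ((i - 1 : ℕ) : ℝ) < (c / ε) * ((N : ℝ) * Real.log N) ∧
      (c / ε) * ((N : ℝ) * Real.log N) ≤ (deg adj u : ℝ) * (i : ℝ) := by
  obtain ⟨h1, h2, hact, hsing⟩ := h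
  refine ⟨?_, threshold_le_of_singleton hsing⟩
  by_contra! hge
  obtain ⟨k, rfl⟩ : ∃ k, i = k + 1 := ⟨i - 1, by omega⟩
  rw [Nat.add_sub_cancel] at hact hge
  cases k with
  | zero =>
    simp only [Nat.cast_zero, mul_zero] at hge
    linarith
  | succ k =>
    have hk : k < N := by omega
    have hprev := active_of_active_succ hact
    rw [seqStates_succ hk] at hact
    have hge' : (c / ε) * ((N : ℝ) * Real.log N) ≤ (deg adj u : ℝ) * ((k : ℝ) + 1) := by
      exact_mod_cast hge
    simp [pivStep, singStep, hprev, hge'] at hact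

/-- Below the degree threshold of `u`, the set `N_{k+1}(u)` consists of nodes at positions
later than `k`. -/
lemma le_position_of_mem_NdegI
    (hlt : (deg adj u : ℝ) * (k : ℝ) < (c / ε) * ((N : ℝ) * Real.log N))
    (hv : v ∈ NdegI adj c ε π (k + 1) u) : k ≤ (π v).val := by
  simp only [NdegI, Finset.mem_filter, Finset.mem_univ, true_and, Nat.add_sub_cancel] at hv
  obtain ⟨-, hdeg, hnc⟩ := hv
  by_contra! hj
  have hsymm : π.symm ⟨(π v).val, (π v).isLt⟩ = v := by simp
  have hbd : ∀ l : ℕ, l ≤ k →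
      (deg adj v : ℝ) * (l : ℝ) < (c / ε) * ((N : ℝ) * Real.log N) := by
    intro l hl
    refine lt_of_le_of_lt ?_ hlt
    gcongr
  have hact : seqStates adj c ε π (π v).val v = Status.active :=
    active_of_not_clustered (hbd _ hj.le) fun p hp => hnc p (clustered_mono hj.le hp)
  exact hnc _ (clustered_mono hj (clustered_succ_of_active (π v).isLt (by rwa [hsymm])
    (by rw [hsymm]; exact hbd _ hj) hact (hbd _ hj) (Or.inl hsymm.symm)))

/-- If `u` is active after iteration `k + 1` and below the degree threshold, then the node of
that iteration is not in `N_{k+1}(u)`. -/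
lemma notMem_NdegI_of_active_succ (hsymm : ∀ u v, adj u v = adj v u) (hk : k < N)
    (hlt : (deg adj u : ℝ) * ((k + 1 : ℕ) : ℝ) < (c / ε) * ((N : ℝ) * Real.log N))
    (hu : seqStates adj c ε π (k + 1) u = Status.active) :
    π.symm ⟨k, hk⟩ ∉ NdegI adj c ε π (k + 1) u := by
  intro hv
  simp only [NdegI, Finset.mem_filter, Finset.mem_univ, true_and, Nat.add_sub_cancel] at hv
  obtain ⟨hadj, hdeg, hnc⟩ := hv
  have hbd : ∀ l : ℕ, l ≤ k + 1 → (deg adj (π.symm ⟨k, hk⟩) : ℝ) * (l : ℝ) <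
      (c / ε) * ((N : ℝ) * Real.log N) := by
    intro l hl
    refine lt_of_le_of_lt ?_ hlt
    gcongr
  have := clustered_succ_of_active hk (active_of_not_clustered (hbd k (Nat.le_succ k)) hnc)
    (hbd _ le_rfl) (active_of_active_succ hu) hlt (Or.inr (by rw [hsymm]; exact hadj))
  simp [this] at hu

/-- The sets `N_i(u)` decrease with `i`. -/
lemma NdegI_succ_subset :
    NdegI adj c ε π (k + 1 + 1) u ⊆ NdegI adj c ε π (k + 1) u := by
  intro v hv
  simp only [NdegI, Finset.mem_filter, Finset.mem_univ, true_and, Nat.add_sub_cancel] at hv ⊢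
  exact ⟨hv.1, hv.2.1, fun p hp => hv.2.2 p (clustered_mono (Nat.le_succ k) hp)⟩

/-- `N_{k+1}(u)` depends only on the first `k` nodes. -/
lemma NdegI_congr {π' : Equiv.Perm (Fin N)}
    (h : ∀ j : Fin N, j.val < k → π.symm j = π'.symm j) :
    NdegI adj c ε π (k + 1) u = NdegI adj c ε π' (k + 1) u := by
  simp only [NdegI, Nat.add_sub_cancel, seqStates_congr h]

end Run

lemma swap_mul_symm_apply {k m j : Fin N} (π : Equiv.Perm (Fin N)) (hm : k ≤ m) (hj : j < k) :
    (Equiv.swap k m * π).symm j = π.symm j := by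
  change π.symm ((Equiv.swap k m).symm j) = π.symm j
  rw [Equiv.symm_swap, Equiv.swap_apply_of_ne_of_ne hj.ne (hj.trans_le hm).ne]

/-- While `u` is below its degree threshold, the number of permutations for which it survives
`k` iterations with `|N_{k+1}(u)| > s` decays geometrically in `k`. -/
lemma card_active_and_lt_card_NdegI_le (adj : Fin N → Fin N → Bool)
    (hsymm : ∀ u v, adj u v = adj v u) (c ε s : ℝ) (u : Fin N) (hs : s ≤ N) (k : ℕ) (hk : k ≤ N)
    (hlt : (deg adj u : ℝ) * (k : ℝ) < (c / ε) * ((N : ℝ) * Real.log N)) :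
    ((Finset.univ.filter fun π => seqStates adj c ε π k u = Status.active ∧
      s < ((NdegI adj c ε π (k + 1) u).card : ℝ)).card : ℝ) ≤
        (N.factorial : ℝ) * (1 - s / N) ^ k := by
  induction k with
  | zero =>
    rw [pow_zero, mul_one]
    refine Nat.cast_le.2 ((Finset.card_le_univ _).trans ?_)
    rw [Fintype.card_perm, Fintype.card_fin]
  | succ k ih =>
    have hkN : k < N := hk
    have hN : (0 : ℝ) < N := Nat.cast_pos.2 (by omega)
    have hlt' : (deg adj u : ℝ) * (k : ℝ) < (c / ε) * ((N : ℝ) * Real.log N) := by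
      refine lt_of_le_of_lt ?_ hlt
      gcongr
      exact Nat.le_succ k
    have ih := ih hkN.le hlt'
    set P : Equiv.Perm (Fin N) → Prop := fun π => seqStates adj c ε π k u = Status.active ∧
      s < ((NdegI adj c ε π (k + 1) u).card : ℝ) with hPdef
    set S : Equiv.Perm (Fin N) → Finset (Fin N) := fun π => NdegI adj c ε π (k + 1) u with hSdef
    have hagree : ∀ m, (⟨k, hkN⟩ : Fin N) ≤ m → ∀ π : Equiv.Perm (Fin N),
        ∀ j : Fin N, j.val < k → (Equiv.swap ⟨k, hkN⟩ m * π).symm j = π.symm j :=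
      fun m hm π j hj => swap_mul_symm_apply π hm hj
    have hhit := card_mul_le_card_hit ⟨k, hkN⟩ P S s
      (fun m hm π hπ => by
        simp only [hPdef]
        rw [seqStates_congr (hagree m hm π), NdegI_congr (hagree m hm π)]
        exact hπ)
      (fun m hm π => NdegI_congr (hagree m hm π))
      (fun π _ v hv => le_position_of_mem_NdegI hlt' hv)
      (fun π hπ => hπ.2.le)
    have hsub : (Finset.univ.filter fun π => seqStates adj c ε π (k + 1) u = Status.active ∧
        s < ((NdegI adj c ε π (k + 1 + 1) u).card : ℝ)).card +
        (Finset.univ.filter fun π => P π ∧ π.symm ⟨k, hkN⟩ ∈ S π).card ≤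
        (Finset.univ.filter P).card := by
      rw [← Finset.card_union_of_disjoint]
      · refine Finset.card_le_card fun π hπ => ?_
        simp only [Finset.mem_union, Finset.mem_filter, Finset.mem_univ, true_and] at hπ ⊢
        rcases hπ with ⟨h1, h2⟩ | h
        · exact ⟨active_of_active_succ h1, h2.trans_le
            (Nat.cast_le.2 (Finset.card_le_card NdegI_succ_subset))⟩
        · exact h.1
      · rw [Finset.disjoint_filter]
        exact fun π _ h1 h2 => notMem_NdegI_of_active_succ hsymm hkN hlt h1.1 h2.2
    have hsub' := (Nat.cast_le (α := ℝ)).2 hsub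
    rw [Nat.cast_add] at hsub'
    have hdiv : s / N * ((Finset.univ.filter P).card : ℝ) ≤
        ((Finset.univ.filter fun π => P π ∧ π.symm ⟨k, hkN⟩ ∈ S π).card : ℝ) := by
      rw [div_mul_eq_mul_div, div_le_iff₀ hN, mul_comm _ (N : ℝ)]
      exact hhit
    have hfac : 0 ≤ 1 - s / N := sub_nonneg.2 ((div_le_one hN).2 hs)
    calc _ ≤ (1 - s / N) * ((Finset.univ.filter P).card : ℝ) := by linarith
      _ ≤ (1 - s / N) * ((N.factorial : ℝ) * (1 - s / N) ^ k) :=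
          mul_le_mul_of_nonneg_left ih hfac
      _ = _ := by ring

/-- The geometric decay evaluated at the iteration at which the degree threshold is met. -/
lemma one_sub_pow_le_rpow {N d k : ℕ} (hN : 2 ≤ N) {c ε : ℝ} (hc : 6 ≤ c) (hε0 : 0 < ε)
    (hε1 : ε < 1) (hd : d ≤ N)
    (hge : (c / ε) * ((N : ℝ) * Real.log N) ≤ (d : ℝ) * ((k : ℝ) + 1)) :
    (1 - ε * d / N) ^ k ≤ (N : ℝ) ^ (-(c / 2)) := by
  have hN0 : (0 : ℝ) < N := Nat.cast_pos.2 (by omega)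
  have hdN : (d : ℝ) ≤ N := Nat.cast_le.2 hd
  have hd0 : (0 : ℝ) ≤ d := Nat.cast_nonneg d
  have hx : ε * d / N ≤ 1 := (div_le_one hN0).2 (by nlinarith)
  have hlog : (1 : ℝ) / 2 ≤ Real.log N := by
    have h2 : Real.log 2 ≤ Real.log N :=
      Real.log_le_log two_pos (by exact_mod_cast hN)
    linarith [Real.log_two_gt_d9]
  have hge' : c * Real.log N ≤ ε * d / N * (k + 1) := by
    have h : c * Real.log N = ε / N * ((c / ε) * ((N : ℝ) * Real.log N)) := by
      field_simp
    rw [h]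
    calc ε / N * ((c / ε) * ((N : ℝ) * Real.log N)) ≤ ε / N * ((d : ℝ) * ((k : ℝ) + 1)) := by
          gcongr
      _ = _ := by ring
  calc (1 - ε * d / N) ^ k ≤ Real.exp (-(ε * d / N)) ^ k :=
        pow_le_pow_left₀ (sub_nonneg.2 hx) (Real.one_sub_le_exp_neg _) k
    _ = Real.exp (k * -(ε * d / N)) := (Real.exp_nat_mul _ k).symm
    _ ≤ Real.exp (Real.log N * -(c / 2)) := by
        refine Real.exp_le_exp.2 ?_
        nlinarith
    _ = (N : ℝ) ^ (-(c / 2)) := (Real.rpow_def_of_pos hN0 _).symm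

/-- For a fixed node, the bad event has probability at most `N ^ (-c/2)`. -/
lemma card_exists_becomesSingletonAt_le (hN : 2 ≤ N) {c ε : ℝ} (hc : 6 ≤ c)
    (hε0 : 0 < ε) (hε1 : ε < 1) (adj : Fin N → Fin N → Bool)
    (hsymm : ∀ u v, adj u v = adj v u) (u : Fin N) :
    ((Finset.univ.filter fun π => ∃ i, becomesSingletonAt adj c ε π u i ∧
      ε * (deg adj u : ℝ) < ((NdegI adj c ε π i u).card : ℝ)).card : ℝ) ≤
        (N.factorial : ℝ) * (N : ℝ) ^ (-(c / 2)) := by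
  have hT : 0 < (c / ε) * ((N : ℝ) * Real.log N) := by
    have h1 : (1 : ℝ) < N := by exact_mod_cast hN
    have := Real.log_pos h1
    positivity
  have hdeg : deg adj u ≤ N := (Finset.card_le_univ _).trans (by simp)
  rcases Finset.eq_empty_or_nonempty (Finset.univ.filter fun π => ∃ i,
    becomesSingletonAt adj c ε π u i ∧
      ε * (deg adj u : ℝ) < ((NdegI adj c ε π i u).card : ℝ)) with he | ⟨π₀, hπ₀⟩
  · rw [he, Finset.card_empty, Nat.cast_zero]
    positivity
  · obtain ⟨i, hi, -⟩ := (Finset.mem_filter.1 hπ₀).2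
    obtain ⟨hlt, hge⟩ := threshold_of_becomesSingletonAt hT hi
    obtain ⟨hi1, hiN, -, -⟩ := hi
    obtain ⟨k, rfl⟩ : ∃ k, i = k + 1 := ⟨i - 1, by omega⟩
    rw [Nat.add_sub_cancel] at hlt
    have hs : ε * (deg adj u : ℝ) ≤ N := by
      have h1 : (deg adj u : ℝ) ≤ N := Nat.cast_le.2 hdeg
      have h2 : (0 : ℝ) ≤ deg adj u := Nat.cast_nonneg _
      nlinarith
    refine le_trans (Nat.cast_le.2 (Finset.card_le_card ?_))
      ((card_active_and_lt_card_NdegI_le adj hsymm c ε _ u hs k (by omega) hlt).trans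
        (mul_le_mul_of_nonneg_left
          (one_sub_pow_le_rpow hN hc hε0 hε1 hdeg (by exact_mod_cast hge)) (Nat.cast_nonneg _)))
    intro π hπ
    simp only [Finset.mem_filter, Finset.mem_univ, true_and] at hπ ⊢
    obtain ⟨j, hj, hcard⟩ := hπ
    obtain ⟨hlt', hge'⟩ := threshold_of_becomesSingletonAt hT hj
    have hd0 : (0 : ℝ) ≤ deg adj u := Nat.cast_nonneg _
    have h1 : k < j := by
      exact_mod_cast lt_of_mul_lt_mul_left (hlt.trans_le hge') hd0
    have h2 : j - 1 < k + 1 := by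
      exact_mod_cast lt_of_mul_lt_mul_left (hlt'.trans_le hge) hd0
    obtain rfl : j = k + 1 := by omega
    exact ⟨hj.2.2.1, hcard⟩

/-- Let `c ≥ 6`, `ε ∈ (0,1)`, `n ≥ 2`. With probability at least
`1 − n^(1−c/2)` over a uniformly random permutation, every node `u` that is placed into a
singleton cluster at some iteration `i` of sequential Truncated-Pivot satisfies
`deg_i(u) ≤ ε·deg(u)`. -/
theorem singleton_nodes_low_degree_whp (N : ℕ) (hN : 2 ≤ N) (c ε : ℝ) (hc : 6 ≤ c)
    (hε0 : 0 < ε) (hε1 : ε < 1) (adj : Fin N → Fin N → Bool)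
    (hsymm : ∀ u v, adj u v = adj v u) (hirr : ∀ u, adj u u = false) :
    1 - (N : ℝ) ^ ((1 : ℝ) - c / 2) ≤
      Pr N (fun π => ∀ i : ℕ, ∀ u : Fin N, becomesSingletonAt adj c ε π u i →
        ((NdegI adj c ε π i u).card : ℝ) ≤ ε * (deg adj u : ℝ)) := by
  have hfac : (0 : ℝ) < (N.factorial : ℝ) := Nat.cast_pos.2 N.factorial_pos
  have hN0 : (0 : ℝ) < N := Nat.cast_pos.2 (by omega)
  set good : Equiv.Perm (Fin N) → Prop := fun π => ∀ i : ℕ, ∀ u : Fin N,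
    becomesSingletonAt adj c ε π u i →
      ((NdegI adj c ε π i u).card : ℝ) ≤ ε * (deg adj u : ℝ) with hgood
  have hbad : ((Finset.univ.filter fun π => ¬ good π).card : ℝ) ≤
      (N.factorial : ℝ) * (N : ℝ) ^ ((1 : ℝ) - c / 2) := by
    have hsub : (Finset.univ.filter fun π => ¬ good π) ⊆
        Finset.univ.biUnion fun u => Finset.univ.filter fun π => ∃ i,
          becomesSingletonAt adj c ε π u i ∧
            ε * (deg adj u : ℝ) < ((NdegI adj c ε π i u).card : ℝ) := by
      intro π hπ
      simp only [hgood, Finset.mem_filter, Finset.mem_univ, true_and, not_forall, not_le] at hπ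
      obtain ⟨i, u, h1, h2⟩ := hπ
      simp only [Finset.mem_biUnion, Finset.mem_filter, Finset.mem_univ, true_and]
      exact ⟨u, i, h1, h2⟩
    have hunion := (Nat.cast_le (α := ℝ)).2
      ((Finset.card_le_card hsub).trans Finset.card_biUnion_le)
    rw [Nat.cast_sum] at hunion
    refine hunion.trans ((Finset.sum_le_sum fun u _ =>
      card_exists_becomesSingletonAt_le hN hc hε0 hε1 adj hsymm u).trans (le_of_eq ?_))
    rw [Finset.sum_const, Finset.card_univ, Fintype.card_fin, nsmul_eq_mul, sub_eq_add_neg,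
      Real.rpow_add hN0, Real.rpow_one]
    ring
  have hsplit := Finset.card_filter_add_card_filter_not (s := Finset.univ) good
  rw [Finset.card_univ, Fintype.card_perm, Fintype.card_fin] at hsplit
  have hsplit' : ((Finset.univ.filter good).card : ℝ) +
      ((Finset.univ.filter fun π => ¬ good π).card : ℝ) = (N.factorial : ℝ) := by
    exact_mod_cast hsplit
  rw [Pr, le_div_iff₀ hfac]
  linarith


end TruncatedPivot
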